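/- Let R ≥ 0 and p > 0, let 𝒢 be a hypergraph and π : V(𝒢) → U a function satisfying |π(E)| = |E| for every E ∈ 𝒢. If the hypergraph π(𝒢) on U is (p,R)-Janson, then 𝒢 is (p,R)-Janson. -/

import Mathlib

open scoped Classical

noncomputable section

/-- Total mass `e(ν)` of a measure `ν` on the hypergraph `G`. -/
def eMass {V : Type*} (G : Finset (Finset V)) (ν : Finset V → ℝ) : ℝ := ∑ E ∈ G, ν E

/-- Degree `d_ν(L)` of a set `L` in the measure `ν`. -/
def dMass {V : Type*} (G : Finset (Finset V)) (ν : Finset V → ℝ) (L : Finset V) : ℝ :=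
  ∑ E ∈ G.filter (fun E => L ⊆ E), ν E

/-- `Λ_p(ν) = Σ_{L ⊆ V, |L| ≥ 2} d_ν(L)² p^{−|L|}`. -/
def lamP {V : Type*} [Fintype V] (p : ℝ) (G : Finset (Finset V)) (ν : Finset V → ℝ) : ℝ :=
  ∑ L ∈ (Finset.univ : Finset (Finset V)).filter (fun L => 2 ≤ L.card),
    dMass G ν L ^ 2 / p ^ L.card

/-- `ν` is a (nonnegative) measure supported on the edges of `G`. -/
def IsMeasureOn {V : Type*} (G : Finset (Finset V)) (ν : Finset V → ℝ) : Prop :=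
  (∀ E, 0 ≤ ν E) ∧ ∀ E, E ∉ G → ν E = 0

/-- The induced subhypergraph `G[X]`. -/
def indHG {V : Type*} (G : Finset (Finset V)) (X : Finset V) : Finset (Finset V) :=
  G.filter (fun E => E ⊆ X)

/-- `G` is `(p,R)`-Janson: for `R > 0` there is a measure `ν` on `G` with
`Λ_p(ν) < e(ν)²/R`; for `R = 0` every hypergraph is `(p,R)`-Janson. -/
def IsJanson {V : Type*} [Fintype V] (p R : ℝ) (G : Finset (Finset V)) : Prop :=
  0 < R → ∃ ν : Finset V → ℝ, IsMeasureOn G ν ∧ lamP p G ν < eMass G ν ^ 2 / R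

/-- `I` is an independent set of the hypergraph `G`: no edge of `G` is a subset of `I`. -/
def IndepIn {V : Type*} (G : Finset (Finset V)) (I : Finset V) : Prop := ∀ E ∈ G, ¬ E ⊆ I

/-- The image hypergraph `π(𝒢) = {π(E) : E ∈ 𝒢}`. -/
def pushHG {V U : Type*} [DecidableEq U] (π : V → U) (G : Finset (Finset V)) :
    Finset (Finset U) :=
  G.image fun E => E.image π

/-- The pullback measure `ϑ∘̂π`, defined by
`(ϑ∘̂π)(E) = ϑ(π(E)) / #{E₀ ∈ 𝒢 : π(E₀) = π(E)}`. -/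
def pullback {V U : Type*} [DecidableEq U] (G : Finset (Finset V)) (π : V → U)
    (θ : Finset U → ℝ) : Finset V → ℝ :=
  fun E => θ (E.image π) / ((G.filter fun E₀ => E₀.image π = E.image π).card : ℝ)

/-- Pulling a function back along `π` preserves its total mass. -/
theorem sum_pullback {V U : Type*} [DecidableEq U] (G : Finset (Finset V)) (π : V → U)
    (f : Finset U → ℝ) : ∑ E ∈ G, pullback G π f E = ∑ F ∈ pushHG π G, f F := by
  rw [← Finset.sum_fiberwise_of_maps_to
    (t := pushHG π G) (g := fun E => E.image π) fun E hE => Finset.mem_image_of_mem _ hE]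
  refine Finset.sum_congr rfl fun F hF => ?_
  obtain ⟨E₁, hE₁, hF₁⟩ := Finset.mem_image.mp hF
  have hconst : ∀ E ∈ G.filter (fun E => E.image π = F),
      pullback G π f E = f F / ((G.filter fun E => E.image π = F).card : ℝ) := by
    intro E hE
    rw [pullback, (Finset.mem_filter.mp hE).2]
  have hcard : ((G.filter fun E => E.image π = F).card : ℝ) ≠ 0 := by
    have hmem : E₁ ∈ G.filter fun E => E.image π = F := Finset.mem_filter.mpr ⟨hE₁, hF₁⟩
    exact_mod_cast Finset.card_ne_zero_of_mem hmem
  rw [Finset.sum_congr rfl hconst, Finset.sum_const, nsmul_eq_mul, mul_div_cancel₀ _ hcard]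

/-- The edges whose image contains `M` have total mass `d_θ(M)` in the pullback of `θ`. -/
theorem sum_pullback_filter_image {V U : Type*} [DecidableEq U] (G : Finset (Finset V))
    (π : V → U) (θ : Finset U → ℝ) (M : Finset U) :
    ∑ E ∈ G.filter (fun E => M ⊆ E.image π), pullback G π θ E = dMass (pushHG π G) θ M := by
  rw [dMass, Finset.sum_filter, Finset.sum_filter, ← sum_pullback]
  refine Finset.sum_congr rfl fun E _ => ?_
  by_cases hM : M ⊆ E.image π <;> simp [pullback, hM]

/-- An edge on which `π` is injective contains at most one set with a given image. -/
theorem sum_dMass_fiber_le {V U : Type*} [Fintype V] [DecidableEq U] (G : Finset (Finset V))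
    (π : V → U) (hπ : ∀ E ∈ G, (E.image π).card = E.card) (ν : Finset V → ℝ)
    (hν : ∀ E, 0 ≤ ν E) (A : Finset (Finset V)) (M : Finset U)
    (hA : ∀ L ∈ A, L.image π = M) :
    ∑ L ∈ A, dMass G ν L ≤ ∑ E ∈ G.filter (fun E => M ⊆ E.image π), ν E := by
  simp only [dMass, Finset.sum_filter]
  rw [Finset.sum_comm]
  refine Finset.sum_le_sum fun E hE => ?_
  rw [← Finset.sum_filter, Finset.sum_const, nsmul_eq_mul]
  have hinj : Set.InjOn π (E : Set V) := Finset.card_image_iff.mp (hπ E hE)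
  split_ifs with hM
  · have hone : (A.filter fun L => L ⊆ E).card ≤ 1 := by
      refine Finset.card_le_one.mpr fun L₁ h₁ L₂ h₂ => ?_
      rw [Finset.mem_filter] at h₁ h₂
      have himage : L₁.image π = L₂.image π := (hA L₁ h₁.1).trans (hA L₂ h₂.1).symm
      have himage' : π '' (L₁ : Set V) = π '' (L₂ : Set V) := by
        simpa only [Finset.coe_image] using congrArg (fun s : Finset U => (s : Set U)) himage
      exact Finset.coe_injective ((hinj.image_eq_image_iff
        (Finset.coe_subset.mpr h₁.2) (Finset.coe_subset.mpr h₂.2)).mp himage')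
    exact mul_le_of_le_one_left (hν E) (by exact_mod_cast hone)
  · have hempty : A.filter (fun L => L ⊆ E) = ∅ :=
      Finset.filter_eq_empty_iff.mpr fun L hL hLE =>
        hM (hA L hL ▸ Finset.image_subset_image hLE)
    simp [hempty]

theorem dMass_nonneg {V : Type*} (G : Finset (Finset V)) {ν : Finset V → ℝ}
    (hν : ∀ E, 0 ≤ ν E) (L : Finset V) : 0 ≤ dMass G ν L :=
  Finset.sum_nonneg fun E _ => hν E

theorem pullback_nonneg {V U : Type*} [DecidableEq U] (G : Finset (Finset V)) (π : V → U)
    {θ : Finset U → ℝ} (hθ : ∀ F, 0 ≤ θ F) (E : Finset V) : 0 ≤ pullback G π θ E :=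
  div_nonneg (hθ _) (Nat.cast_nonneg _)

theorem dMass_eq_zero_of_card_image_ne {V U : Type*} [DecidableEq U] (G : Finset (Finset V))
    (π : V → U) (hπ : ∀ E ∈ G, (E.image π).card = E.card) (ν : Finset V → ℝ) {L : Finset V}
    (hL : (L.image π).card ≠ L.card) : dMass G ν L = 0 := by
  have hempty : G.filter (fun E => L ⊆ E) = ∅ :=
    Finset.filter_eq_empty_iff.mpr fun E hE hLE =>
      hL (Finset.card_image_iff.mpr ((Finset.card_image_iff.mp (hπ E hE)).mono
        (Finset.coe_subset.mpr hLE)))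
  rw [dMass, hempty, Finset.sum_empty]

theorem lamP_pullback_le {V U : Type*} [Fintype V] [Fintype U] [DecidableEq U]
    {p : ℝ} (hp : 0 < p) (G : Finset (Finset V)) (π : V → U)
    (hπ : ∀ E ∈ G, (E.image π).card = E.card) {θ : Finset U → ℝ} (hθ : ∀ F, 0 ≤ θ F) :
    lamP p G (pullback G π θ) ≤ lamP p (pushHG π G) θ := by
  have hν := pullback_nonneg G π hθ
  unfold lamP
  rw [← Finset.sum_filter_of_ne (p := fun L : Finset V => (L.image π).card = L.card)
    fun L _ hne => by
      by_contra hL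
      exact hne (by simp [dMass_eq_zero_of_card_image_ne G π hπ _ hL])]
  rw [← Finset.sum_fiberwise_of_maps_to
    (t := (Finset.univ : Finset (Finset U)).filter fun M => 2 ≤ M.card)
    (g := fun L => L.image π) fun L hL => by
      simp only [Finset.mem_filter, Finset.mem_univ, true_and] at hL ⊢
      exact hL.2 ▸ hL.1]
  refine Finset.sum_le_sum fun M _ => ?_
  set A := (((Finset.univ : Finset (Finset V)).filter fun L => 2 ≤ L.card).filter
    fun L => (L.image π).card = L.card).filter fun L => L.image π = M with hA
  have hcard : ∀ L ∈ A, L.card = M.card := by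
    intro L hL
    simp only [hA, Finset.mem_filter] at hL
    rw [← hL.1.2, hL.2]
  calc ∑ L ∈ A, dMass G (pullback G π θ) L ^ 2 / p ^ L.card
      = (∑ L ∈ A, dMass G (pullback G π θ) L ^ 2) / p ^ M.card := by
        rw [Finset.sum_div]
        exact Finset.sum_congr rfl fun L hL => by rw [hcard L hL]
    _ ≤ (∑ L ∈ A, dMass G (pullback G π θ) L) ^ 2 / p ^ M.card := by
        gcongr
        exact Finset.sum_sq_le_sq_sum_of_nonneg fun L _ => dMass_nonneg G hν L
    _ ≤ dMass (pushHG π G) θ M ^ 2 / p ^ M.card := by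
        gcongr
        · exact Finset.sum_nonneg fun L _ => dMass_nonneg G hν L
        · rw [← sum_pullback_filter_image]
          exact sum_dMass_fiber_le G π hπ _ hν A M fun L hL => (Finset.mem_filter.mp hL).2

theorem dMass_congr {V : Type*} {G : Finset (Finset V)} {ν μ : Finset V → ℝ}
    (h : ∀ E ∈ G, ν E = μ E) (L : Finset V) : dMass G ν L = dMass G μ L :=
  Finset.sum_congr rfl fun E hE => h E (Finset.mem_filter.mp hE).1

/-- **Lemma 3.5.**  Suppose `|π(E)| = |E|` for every `E ∈ 𝒢`.  If `π(𝒢)` is `(p,R)`-Janson,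
then so is `𝒢`. -/
theorem janson_of_push {V U : Type*} [Fintype V] [Fintype U] [DecidableEq U]
    (R p : ℝ) (hR : 0 ≤ R) (hp : 0 < p)
    (G : Finset (Finset V)) (π : V → U)
    (hπ : ∀ E ∈ G, (E.image π).card = E.card)
    (h : IsJanson p R (pushHG π G)) :
    IsJanson p R G := by
  intro hRpos
  obtain ⟨θ, ⟨hθ, -⟩, hlt⟩ := h hRpos
  -- The pullback may charge non-edges with the same image as an edge, so restrict it to `G`.
  have hν : ∀ E ∈ G, (if E ∈ G then pullback G π θ E else 0) = pullback G π θ E :=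
    fun E hE => if_pos hE
  refine ⟨fun E => if E ∈ G then pullback G π θ E else 0, ⟨fun E => ?_, fun E hE => if_neg hE⟩, ?_⟩
  · dsimp only
    split_ifs
    exacts [pullback_nonneg G π hθ E, le_rfl]
  · have hmass : eMass G (fun E => if E ∈ G then pullback G π θ E else 0)
        = eMass (pushHG π G) θ :=
      (Finset.sum_congr rfl hν).trans (sum_pullback G π θ)
    rw [hmass]
    refine lt_of_le_of_lt ?_ hlt
    simpa only [lamP, dMass_congr hν] using lamP_pullback_le hp G π hπ hθ

end
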